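/- For all M ≥ 1 and M₀ ≥ 1 there exists a constant C > 0, depending only on M and M₀, with the following property: whenever g is a real symmetric invertible 4×4 matrix of Lorentzian signature with operator norms ‖g‖ ≤ M and ‖g^{-1}‖ ≤ M, and σ ∈ ℝ⁴ satisfies |σ| ≤ M and −σᵀ g^{-1} σ ≥ 1/M₀², then the positive definite matrix e := g + 2 σ̂ σ̂ᵀ, where σ̂ := σ / √(−σᵀ g^{-1} σ), satisfies ‖e‖ ≤ C and ‖e^{-1}‖ ≤ C. -/

import Mathlib

open Matrix

/-- The Minkowski matrix diag(-1,1,1,1). -/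
def minkowskiMat : Matrix (Fin 4) (Fin 4) ℝ :=
  Matrix.diagonal (fun i => if i = 0 then -1 else 1)

/-- A real symmetric 4×4 matrix has Lorentzian signature if it is congruent to
diag(-1,1,1,1). -/
def IsLorentzian (g : Matrix (Fin 4) (Fin 4) ℝ) : Prop :=
  ∃ P : Matrix (Fin 4) (Fin 4) ℝ, IsUnit P.det ∧ Pᵀ * g * P = minkowskiMat

/-- The ℓ²-operator norm of a real 4×4 matrix. -/
noncomputable def opNorm (g : Matrix (Fin 4) (Fin 4) ℝ) : ℝ :=
  ‖Matrix.toEuclideanCLM (𝕜 := ℝ) g‖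

theorem opNorm_add_le (a b : Matrix (Fin 4) (Fin 4) ℝ) :
    opNorm (a + b) ≤ opNorm a + opNorm b := by
  simpa only [opNorm, map_add] using norm_add_le _ _

theorem opNorm_smul (c : ℝ) (a : Matrix (Fin 4) (Fin 4) ℝ) :
    opNorm (c • a) = |c| * opNorm a := by
  simp only [opNorm, map_smul, norm_smul, Real.norm_eq_abs]

theorem norm_toLp_mulVec_le (a : Matrix (Fin 4) (Fin 4) ℝ) (v : Fin 4 → ℝ) :
    ‖WithLp.toLp 2 (a *ᵥ v)‖ ≤ opNorm a * ‖WithLp.toLp 2 v‖ := by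
  rw [← Matrix.toEuclideanCLM_toLp (𝕜 := ℝ)]
  exact ContinuousLinearMap.le_opNorm _ _

theorem opNorm_vecMulVec_self_le (u : Fin 4 → ℝ) :
    opNorm (vecMulVec u u) ≤ ‖WithLp.toLp 2 u‖ ^ 2 := by
  refine ContinuousLinearMap.opNorm_le_bound _ (by positivity) fun x => ?_
  have hx : Matrix.toEuclideanCLM (𝕜 := ℝ) (vecMulVec u u) x
      = inner ℝ (WithLp.toLp 2 u) x • WithLp.toLp 2 u := by
    ext i
    simp [Matrix.ofLp_toEuclideanCLM, vecMulVec_mulVec, EuclideanSpace.inner_eq_star_dotProduct,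
      dotProduct_comm, mul_comm]
  rw [hx, norm_smul]
  have h := norm_inner_le_norm (𝕜 := ℝ) (WithLp.toLp 2 u) x
  calc _ ≤ ‖WithLp.toLp 2 u‖ * ‖x‖ * ‖WithLp.toLp 2 u‖ := by gcongr
    _ = _ := by ring

/-- A symmetric matrix plus twice the square of a covector that is unit timelike for its inverse
is inverted by raising the index of the covector. -/
theorem inv_add_two_smul_vecMulVec {n : Type*} [Fintype n] [DecidableEq n] {g : Matrix n n ℝ}
    (hg : g.IsSymm) (hdet : IsUnit g.det) {s : n → ℝ} (hs : s ⬝ᵥ g⁻¹ *ᵥ s = -1) :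
    (g + (2 : ℝ) • vecMulVec s s)⁻¹
      = g⁻¹ + (2 : ℝ) • vecMulVec (g⁻¹ *ᵥ s) (g⁻¹ *ᵥ s) := by
  apply Matrix.inv_eq_right_inv
  have hgs : g *ᵥ (g⁻¹ *ᵥ s) = s := by
    rw [mulVec_mulVec, Matrix.mul_nonsing_inv _ hdet, one_mulVec]
  have hsg : s ᵥ* g⁻¹ = g⁻¹ *ᵥ s := by
    rw [← mulVec_transpose, Matrix.transpose_nonsing_inv, hg.eq]
  rw [mul_add, Matrix.mul_smul, mul_vecMulVec, add_mulVec, smul_mulVec, vecMulVec_mulVec, hs, hgs,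
    add_mul, Matrix.smul_mul, vecMulVec_mul, hsg, Matrix.mul_nonsing_inv _ hdet]
  ext i j
  simp [vecMulVec_apply]
  ring

theorem opNorm_add_two_smul_vecMulVec_le {a : Matrix (Fin 4) (Fin 4) ℝ} {u : Fin 4 → ℝ} {A B : ℝ}
    (ha : opNorm a ≤ A) (hu : ‖WithLp.toLp 2 u‖ ≤ B) :
    opNorm (a + (2 : ℝ) • vecMulVec u u) ≤ A + 2 * B ^ 2 := by
  refine (opNorm_add_le _ _).trans (add_le_add ha ?_)
  rw [opNorm_smul, abs_two]
  have := opNorm_vecMulVec_self_le u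
  gcongr
  exact this.trans (by gcongr)

/-- Under uniform bounds on `g`, `g⁻¹` and `σ`, and the uniform timelikeness bound
`-σᵀ g⁻¹ σ ≥ 1/M₀²`, the associated Riemannian metric `e = g + 2 σ̂ σ̂ᵀ` and its inverse
are bounded by a constant depending only on `M` and `M₀`. -/
theorem riemannian_metric_uniform_bounds :
    ∀ M : ℝ, 1 ≤ M → ∀ M₀ : ℝ, 1 ≤ M₀ → ∃ C > (0:ℝ),
      ∀ (g : Matrix (Fin 4) (Fin 4) ℝ) (σ : Fin 4 → ℝ),
        g.IsSymm → IsUnit g.det → IsLorentzian g →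
        opNorm g ≤ M → opNorm g⁻¹ ≤ M → Real.sqrt (∑ i, σ i ^ 2) ≤ M →
        1 / M₀ ^ 2 ≤ -(σ ⬝ᵥ g⁻¹.mulVec σ) →
        opNorm (g + (2:ℝ) • Matrix.vecMulVec
            ((Real.sqrt (-(σ ⬝ᵥ g⁻¹.mulVec σ)))⁻¹ • σ)
            ((Real.sqrt (-(σ ⬝ᵥ g⁻¹.mulVec σ)))⁻¹ • σ)) ≤ C ∧
        opNorm (g + (2:ℝ) • Matrix.vecMulVec
            ((Real.sqrt (-(σ ⬝ᵥ g⁻¹.mulVec σ)))⁻¹ • σ)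
            ((Real.sqrt (-(σ ⬝ᵥ g⁻¹.mulVec σ)))⁻¹ • σ))⁻¹ ≤ C := by
  intro M hM M₀ hM₀
  refine ⟨M + 2 * (M * (M₀ * M)) ^ 2, by positivity, ?_⟩
  intro g σ hg hdet _ hgM hgiM hσ ht
  set q := -(σ ⬝ᵥ g⁻¹.mulVec σ) with hq
  have hM₀' : 0 < M₀ := by linarith
  have hq0 : 0 < q := lt_of_lt_of_le (by positivity) ht
  have hr : (√q)⁻¹ ≤ M₀ := by
    rw [inv_le_comm₀ (Real.sqrt_pos.2 hq0) hM₀']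
    apply Real.le_sqrt_of_sq_le
    rwa [inv_pow, ← one_div]
  have hσn : ‖WithLp.toLp 2 ((√q)⁻¹ • σ)‖ ≤ M₀ * M := by
    rw [WithLp.toLp_smul, norm_smul, Real.norm_of_nonneg (by positivity)]
    have : ‖WithLp.toLp 2 σ‖ ≤ M := by
      simpa [EuclideanSpace.norm_eq] using hσ
    gcongr
  have hs : ((√q)⁻¹ • σ) ⬝ᵥ g⁻¹ *ᵥ ((√q)⁻¹ • σ) = -1 := by
    have h2 : σ ⬝ᵥ g⁻¹ *ᵥ σ = -q := by rw [hq, neg_neg]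
    rw [mulVec_smul, smul_dotProduct, dotProduct_smul, h2, smul_eq_mul, smul_eq_mul, ← mul_assoc,
      ← mul_inv, Real.mul_self_sqrt hq0.le]
    field_simp
  constructor
  · refine opNorm_add_two_smul_vecMulVec_le hgM (hσn.trans ?_)
    exact le_mul_of_one_le_left (by positivity) hM
  · rw [inv_add_two_smul_vecMulVec hg hdet hs]
    refine opNorm_add_two_smul_vecMulVec_le hgiM ((norm_toLp_mulVec_le _ _).trans ?_)
    gcongr
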